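/- Let X be a bounded chain. A function f : Xⁿ → X is a polynomial function if and only if it satisfies all of the following: (a) δ_f(c) = c for every c in the convex hull of the range of f; (b) f is comonotonic minitive: for every permutation σ of {1,…,n} and all x, x′ in the standard simplex Xⁿ_σ, f(x ∧ x′) = f(x) ∧ f(x′); and (c) f is comonotonic maxitive: for every permutation σ of {1,…,n} and all x, x′ ∈ Xⁿ_σ, f(x ∨ x′) = f(x) ∨ f(x′). -/

import Mathlib

/-- Lattice polynomial functions in `n` variables on a bounded distributive lattice. -/
inductive IsLatticePolynomial {L : Type*} [DistribLattice L] [BoundedOrder L] {n : ℕ} :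
    ((Fin n → L) → L) → Prop
  | proj (i : Fin n) : IsLatticePolynomial (fun x => x i)
  | const (c : L) : IsLatticePolynomial (fun _ => c)
  | inf {p q : (Fin n → L) → L} :
      IsLatticePolynomial p → IsLatticePolynomial q → IsLatticePolynomial (fun x => p x ⊓ q x)
  | sup {p q : (Fin n → L) → L} :
      IsLatticePolynomial p → IsLatticePolynomial q → IsLatticePolynomial (fun x => p x ⊔ q x)

/-- A subset `S` of a lattice is convex. -/
def IsConvexSet {X : Type*} [Lattice X] (S : Set X) : Prop :=
  ∀ a ∈ S, ∀ b ∈ S, ∀ c : X, a ≤ c → c ≤ b → c ∈ S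

/-- The convex hull of `S`: the smallest convex subset containing `S`. -/
def latticeConvexHull {X : Type*} [Lattice X] (S : Set X) : Set X :=
  ⋂₀ {T : Set X | S ⊆ T ∧ IsConvexSet T}

namespace IsLatticePolynomial

section DistribLattice

variable {L : Type*} [DistribLattice L] [BoundedOrder L] {n : ℕ}

theorem monotone {p : (Fin n → L) → L} (hp : IsLatticePolynomial p) : Monotone p := by
  induction hp with
  | proj i => exact fun x y h => h i
  | const c => exact fun x y _ => le_rfl
  | inf _ _ ihp ihq => exact fun x y h => inf_le_inf (ihp h) (ihq h)
  | sup _ _ ihp ihq => exact fun x y h => sup_le_sup (ihp h) (ihq h)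

theorem finset_inf {ι : Type*} (s : Finset ι) {p : ι → (Fin n → L) → L}
    (hp : ∀ i, IsLatticePolynomial (p i)) :
    IsLatticePolynomial (fun x => s.inf fun i => p i x) := by
  classical
  induction s using Finset.induction_on with
  | empty => simpa using const ⊤
  | insert a s _ ih => simpa [Finset.inf_insert] using (hp a).inf ih

theorem finset_sup {ι : Type*} (s : Finset ι) {p : ι → (Fin n → L) → L}
    (hp : ∀ i, IsLatticePolynomial (p i)) :
    IsLatticePolynomial (fun x => s.sup fun i => p i x) := by
  classical
  induction s using Finset.induction_on with
  | empty => simpa using const ⊥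
  | insert a s _ ih => simpa [Finset.sup_insert] using (hp a).sup ih

end DistribLattice

variable {X : Type*} [LinearOrder X] [BoundedOrder X] {n : ℕ}

/-- On a standard simplex, each upper level condition of a polynomial function is either trivial or
an upper level condition on a single coordinate. -/
theorem le_apply_iff_of_simplex {p : (Fin n → X) → X} (hp : IsLatticePolynomial p)
    (σ : Equiv.Perm (Fin n)) (t : X) :
    (∀ x : Fin n → X, Monotone (fun i => x (σ i)) → t ≤ p x) ∨
    (∀ x : Fin n → X, Monotone (fun i => x (σ i)) → ¬ t ≤ p x) ∨
    ∃ i, ∀ x : Fin n → X, Monotone (fun i => x (σ i)) → (t ≤ p x ↔ t ≤ x (σ i)) := by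
  induction hp with
  | proj i => exact Or.inr (Or.inr ⟨σ.symm i, fun x _ => by simp⟩)
  | const c =>
    by_cases h : t ≤ c
    · exact Or.inl fun _ _ => h
    · exact Or.inr (Or.inl fun _ _ => h)
  | inf _ _ ihp ihq =>
    simp only [le_inf_iff]
    rcases ihp with hp | hp | ⟨i, hi⟩
    · rcases ihq with hq | hq | ⟨j, hj⟩
      · exact Or.inl fun x hx => ⟨hp x hx, hq x hx⟩
      · exact Or.inr (Or.inl fun x hx h => hq x hx h.2)
      · exact Or.inr (Or.inr ⟨j, fun x hx => by simp [hp x hx, hj x hx]⟩)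
    · exact Or.inr (Or.inl fun x hx h => hp x hx h.1)
    · rcases ihq with hq | hq | ⟨j, hj⟩
      · exact Or.inr (Or.inr ⟨i, fun x hx => by simp [hq x hx, hi x hx]⟩)
      · exact Or.inr (Or.inl fun x hx h => hq x hx h.2)
      · refine Or.inr (Or.inr ⟨min i j, fun x hx => ?_⟩)
        rw [hi x hx, hj x hx, ← le_inf_iff]
        exact iff_of_eq (congrArg _ (hx.map_min (a := i) (b := j)).symm)
  | sup _ _ ihp ihq =>
    simp only [le_sup_iff]
    rcases ihp with hp | hp | ⟨i, hi⟩
    · exact Or.inl fun x hx => Or.inl (hp x hx)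
    · rcases ihq with hq | hq | ⟨j, hj⟩
      · exact Or.inl fun x hx => Or.inr (hq x hx)
      · exact Or.inr (Or.inl fun x hx h => h.elim (hp x hx) (hq x hx))
      · exact Or.inr (Or.inr ⟨j, fun x hx => by simp [hp x hx, hj x hx]⟩)
    · rcases ihq with hq | hq | ⟨j, hj⟩
      · exact Or.inl fun x hx => Or.inr (hq x hx)
      · exact Or.inr (Or.inr ⟨i, fun x hx => by simp [hq x hx, hi x hx]⟩)
      · refine Or.inr (Or.inr ⟨max i j, fun x hx => ?_⟩)
        rw [hi x hx, hj x hx, ← le_sup_iff]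
        exact iff_of_eq (congrArg _ (hx.map_max (a := i) (b := j)).symm)

theorem map_inf_of_simplex {p : (Fin n → X) → X} (hp : IsLatticePolynomial p)
    (σ : Equiv.Perm (Fin n)) {x y : Fin n → X}
    (hx : Monotone (fun i => x (σ i))) (hy : Monotone (fun i => y (σ i))) :
    p (x ⊓ y) = p x ⊓ p y := by
  have hxy : Monotone (fun i => (x ⊓ y) (σ i)) := hx.inf hy
  refine eq_of_forall_le_iff fun t => ?_
  rw [le_inf_iff]
  rcases hp.le_apply_iff_of_simplex σ t with h | h | ⟨i, hi⟩
  · simp [h x hx, h y hy, h _ hxy]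
  · simp [h x hx, h _ hxy]
  · simp [hi x hx, hi y hy, hi _ hxy]

theorem map_sup_of_simplex {p : (Fin n → X) → X} (hp : IsLatticePolynomial p)
    (σ : Equiv.Perm (Fin n)) {x y : Fin n → X}
    (hx : Monotone (fun i => x (σ i))) (hy : Monotone (fun i => y (σ i))) :
    p (x ⊔ y) = p x ⊔ p y := by
  have hxy : Monotone (fun i => (x ⊔ y) (σ i)) := hx.sup hy
  refine eq_of_forall_le_iff fun t => ?_
  rw [le_sup_iff]
  rcases hp.le_apply_iff_of_simplex σ t with h | h | ⟨i, hi⟩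
  · simp [h x hx, h _ hxy]
  · simp [h x hx, h y hy, h _ hxy]
  · simp [hi x hx, hi y hy, hi _ hxy]

theorem diagonal_eq {p : (Fin n → X) → X} (hp : IsLatticePolynomial p) {c : X}
    (hbot : p ⊥ ≤ c) (htop : c ≤ p ⊤) : p (fun _ => c) = c := by
  refine eq_of_forall_le_iff fun t => ?_
  have hc : ∀ d : X, Monotone (fun _ : Fin n => d) := fun _ => monotone_const
  rcases hp.le_apply_iff_of_simplex 1 t with h | h | ⟨i, hi⟩
  · exact iff_of_true (h _ (hc c)) ((h ⊥ (hc ⊥)).trans hbot)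
  · exact iff_of_false (h _ (hc c)) fun htc => h ⊤ (hc ⊤) (htc.trans htop)
  · exact hi _ (hc c)

end IsLatticePolynomial

theorem mem_latticeConvexHull_of_le_of_le {X : Type*} [Lattice X] {S : Set X} {a b c : X}
    (ha : a ∈ S) (hb : b ∈ S) (hac : a ≤ c) (hcb : c ≤ b) : c ∈ latticeConvexHull S :=
  fun _ hT => hT.2 a (hT.1 ha) b (hT.1 hb) c hac hcb

theorem latticeConvexHull_subset_Icc {X : Type*} [Lattice X] {S : Set X} {a b : X}
    (h : S ⊆ Set.Icc a b) : latticeConvexHull S ⊆ Set.Icc a b :=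
  Set.sInter_subset_of_mem
    ⟨h, fun _ hx _ hy _ hxc hcy => ⟨hx.1.trans hxc, hcy.trans hy.2⟩⟩

/-- The indicator tuple of a set of coordinates. -/
def indicatorTuple (X : Type*) [LE X] [BoundedOrder X] {n : ℕ} (S : Finset (Fin n)) :
    Fin n → X :=
  fun i => if i ∈ S then ⊤ else ⊥

section Comonotonic

variable {X : Type*} [LinearOrder X] [BoundedOrder X] {n : ℕ} {f : (Fin n → X) → X}

omit [BoundedOrder X] in
/-- An operation on tuples preserved by `f` on each standard simplex is preserved by `f` on tuples
that are monotone functions of a common tuple. -/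
theorem map_op_comp_of_simplex {op : (Fin n → X) → (Fin n → X) → Fin n → X} {op' : X → X → X}
    (H : ∀ (σ : Equiv.Perm (Fin n)) (x x' : Fin n → X),
      Monotone (fun i => x (σ i)) → Monotone (fun i => x' (σ i)) →
      f (op x x') = op' (f x) (f x'))
    {ι : Type*} [LinearOrder ι] (u : Fin n → ι) {g h : ι → X} (hg : Monotone g)
    (hh : Monotone h) : f (op (g ∘ u) (h ∘ u)) = op' (f (g ∘ u)) (f (h ∘ u)) :=
  H (Tuple.sort u) _ _ (hg.comp (Tuple.monotone_sort u)) (hh.comp (Tuple.monotone_sort u))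

variable
  (hdiag : ∀ c ∈ latticeConvexHull (Set.range f), f (fun _ => c) = c)
  (hinf : ∀ (σ : Equiv.Perm (Fin n)) (x x' : Fin n → X),
    Monotone (fun i => x (σ i)) → Monotone (fun i => x' (σ i)) → f (x ⊓ x') = f x ⊓ f x')
  (hsup : ∀ (σ : Equiv.Perm (Fin n)) (x x' : Fin n → X),
    Monotone (fun i => x (σ i)) → Monotone (fun i => x' (σ i)) → f (x ⊔ x') = f x ⊔ f x')

include hinf

omit [BoundedOrder X] in
theorem apply_comp_le_of_simplex {ι : Type*} [LinearOrder ι] (u : Fin n → ι) {g h : ι → X}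
    (hg : Monotone g) (hh : Monotone h) (hle : g ∘ u ≤ h ∘ u) : f (g ∘ u) ≤ f (h ∘ u) := by
  have := map_op_comp_of_simplex hinf u hg hh
  rw [inf_eq_left.2 hle] at this
  exact inf_eq_left.1 this.symm

theorem apply_bot_le_of_simplex (x : Fin n → X) : f (fun _ => ⊥) ≤ f x :=
  apply_comp_le_of_simplex hinf x (g := fun _ => ⊥) (h := id) monotone_const monotone_id
    fun _ => bot_le

theorem apply_le_top_of_simplex (x : Fin n → X) : f x ≤ f (fun _ => ⊤) :=
  apply_comp_le_of_simplex hinf x (g := id) (h := fun _ => ⊤) monotone_id monotone_const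
    fun _ => le_top

theorem apply_indicatorTuple_mono {S T : Finset (Fin n)} (hST : S ⊆ T) :
    f (indicatorTuple X S) ≤ f (indicatorTuple X T) := by
  let u : Fin n → ℕ := fun i => if i ∈ S then 2 else if i ∈ T then 1 else 0
  let g : ℕ → ℕ → X := fun m k => if m ≤ k then ⊤ else ⊥
  have hg : ∀ m, Monotone (g m) := by
    intro m a b hab
    by_cases ha : m ≤ a
    · simp [g, ha, ha.trans hab]
    · simp [g, ha]
  have hS : indicatorTuple X S = g 2 ∘ u := by
    funext i
    by_cases h : i ∈ S <;> by_cases h' : i ∈ T <;> simp [indicatorTuple, g, u, h, h']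
  have hT : indicatorTuple X T = g 1 ∘ u := by
    funext i
    by_cases h : i ∈ S
    · simp [indicatorTuple, g, u, h, hST h]
    · by_cases h' : i ∈ T <;> simp [indicatorTuple, g, u, h, h']
  have hle : indicatorTuple X S ≤ indicatorTuple X T := by
    intro i
    by_cases h : i ∈ S
    · simp [indicatorTuple, h, hST h]
    · simp [indicatorTuple, h]
  rw [hS, hT] at hle ⊢
  exact apply_comp_le_of_simplex hinf u (hg 2) (hg 1) hle

include hdiag

theorem diagonal_eq_clamp (t : X) :
    f (fun _ => t) = f (fun _ => ⊥) ⊔ (t ⊓ f (fun _ => ⊤)) := by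
  have hmono : ∀ {a b : X}, a ≤ b → f (fun _ => a) ≤ f (fun _ => b) := fun {a b} hab =>
    apply_comp_le_of_simplex hinf (fun _ => (⊥ : X)) (g := fun _ => a) (h := fun _ => b)
      monotone_const monotone_const fun _ => hab
  have hmem : ∀ c, f (fun _ => ⊥) ≤ c → c ≤ f (fun _ => ⊤) → f (fun _ => c) = c := fun c h h' =>
    hdiag c (mem_latticeConvexHull_of_le_of_le ⟨_, rfl⟩ ⟨_, rfl⟩ h h')
  have hbt : f (fun _ => ⊥) ≤ f (fun _ => ⊤) := hmono bot_le
  rcases le_total t (f fun _ => ⊥) with h | h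
  · rw [sup_eq_left.2 (inf_le_left.trans h)]
    exact le_antisymm ((hmono h).trans_eq (hmem _ le_rfl hbt)) (hmono bot_le)
  · rcases le_total t (f fun _ => ⊤) with h' | h'
    · rw [inf_eq_left.2 h', sup_eq_right.2 h, hmem t h h']
    · rw [inf_eq_right.2 h', sup_eq_right.2 hbt]
      exact le_antisymm (hmono le_top) ((hmem _ hbt le_rfl).symm.trans_le (hmono h'))

theorem apply_indicatorTuple_inf_le (S : Finset (Fin n)) (x : Fin n → X) :
    f (indicatorTuple X S) ⊓ S.inf x ≤ f x := by
  set t := S.inf x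
  let T : Finset (Fin n) := Finset.univ.filter fun i => t ≤ x i
  have hST : S ⊆ T := fun i hi => by simpa [T] using Finset.inf_le hi
  let g : X → X := fun y => if t ≤ y then ⊤ else ⊥
  have hg : Monotone g := by
    intro a b hab
    by_cases ha : t ≤ a
    · simp [g, ha, ha.trans hab]
    · simp [g, ha]
  have hT : indicatorTuple X T = g ∘ x := by
    funext i
    simp [indicatorTuple, g, T]
  have hmeet : f (fun i => g (x i) ⊓ t) = f (g ∘ x) ⊓ f (fun _ => t) :=
    map_op_comp_of_simplex hinf x hg (h := fun _ => t) monotone_const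
  have hle : f (fun i => g (x i) ⊓ t) ≤ f x := by
    refine apply_comp_le_of_simplex hinf x (g := fun y => g y ⊓ t) (h := id)
      (hg.inf monotone_const) monotone_id fun i => ?_
    by_cases hi : t ≤ x i <;> simp [g, hi]
  refine le_trans ?_ hle
  rw [hmeet, ← hT, diagonal_eq_clamp hdiag hinf]
  have h1 := apply_indicatorTuple_mono hinf hST
  exact le_inf (inf_le_left.trans h1) (le_sup_of_le_right
    (le_inf inf_le_right (inf_le_left.trans (apply_le_top_of_simplex hinf _))))

include hsup

theorem apply_le_sup_indicatorTuple (x : Fin n → X) :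
    f x ≤ Finset.univ.sup fun S : Finset (Fin n) => f (indicatorTuple X S) ⊓ S.inf x := by
  set G := Finset.univ.sup fun S : Finset (Fin n) => f (indicatorTuple X S) ⊓ S.inf x
  have hG : ∀ S : Finset (Fin n), f (indicatorTuple X S) ⊓ S.inf x ≤ G := fun S =>
    Finset.le_sup (f := fun S : Finset (Fin n) => f (indicatorTuple X S) ⊓ S.inf x)
      (Finset.mem_univ S)
  have hbot : f (fun _ => ⊥) ≤ G := by
    have hempty : indicatorTuple X (∅ : Finset (Fin n)) = fun _ => ⊥ := by
      funext i
      simp [indicatorTuple]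
    simpa [hempty] using hG ∅
  let g : Fin n → X → X := fun i y => if x i ≤ y then ⊤ else ⊥
  have hg : ∀ i, Monotone (g i) := by
    intro i a b hab
    by_cases ha : x i ≤ a
    · simp [g, ha, ha.trans hab]
    · simp [g, ha]
  have hterm : ∀ i, f (fun j => x i ⊓ g i (x j)) ≤ G := by
    intro i
    let T : Finset (Fin n) := Finset.univ.filter fun j => x i ≤ x j
    have hT : indicatorTuple X T = g i ∘ x := by
      funext j
      simp [indicatorTuple, g, T]
    have hmeet : f (fun j => x i ⊓ g i (x j)) = f (fun _ => x i) ⊓ f (g i ∘ x) :=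
      map_op_comp_of_simplex hinf x (g := fun _ => x i) monotone_const (hg i)
    rw [hmeet, ← hT, diagonal_eq_clamp hdiag hinf, inf_sup_right]
    refine sup_le (inf_le_left.trans hbot) (le_trans ?_ (hG T))
    refine le_inf inf_le_right ((inf_le_left.trans inf_le_left).trans ?_)
    exact Finset.le_inf fun j hj => by simpa [T] using hj
  have hall : ∀ s : Finset (Fin n), f (fun j => s.sup fun i => x i ⊓ g i (x j)) ≤ G := by
    intro s
    induction s using Finset.induction_on with
    | empty => simpa using hbot
    | insert a s _ ih =>
      have hjoin : f (fun j => (x a ⊓ g a (x j)) ⊔ s.sup fun i => x i ⊓ g i (x j)) =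
          f (fun j => x a ⊓ g a (x j)) ⊔ f (fun j => s.sup fun i => x i ⊓ g i (x j)) :=
        map_op_comp_of_simplex hsup x (g := fun y => x a ⊓ g a y)
          (h := fun y => s.sup fun i => x i ⊓ g i y)
          (monotone_const.inf (hg a))
          fun y z hyz => Finset.sup_mono_fun fun i _ => inf_le_inf_left _ (hg i hyz)
      simp only [Finset.sup_insert]
      rw [hjoin]
      exact sup_le (hterm a) ih
  have hx : x = fun j => Finset.univ.sup fun i => x i ⊓ g i (x j) := by
    funext j
    refine le_antisymm ?_ (Finset.sup_le fun i _ => ?_)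
    · refine le_trans ?_ (Finset.le_sup (Finset.mem_univ j))
      simp [g]
    · by_cases h : x i ≤ x j <;> simp [g, h]
  exact (congrArg f hx).trans_le (hall Finset.univ)

/-- The disjunctive normal form of a function satisfying the comonotonicity conditions. -/
theorem apply_eq_sup_indicatorTuple (x : Fin n → X) :
    f x = Finset.univ.sup fun S : Finset (Fin n) => f (indicatorTuple X S) ⊓ S.inf x :=
  le_antisymm (apply_le_sup_indicatorTuple hdiag hinf hsup x)
    (Finset.sup_le fun S _ => apply_indicatorTuple_inf_le hdiag hinf S x)

end Comonotonic

theorem statement_19 {X : Type*} [LinearOrder X] [BoundedOrder X] {n : ℕ} (hn : 0 < n)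
    (f : (Fin n → X) → X) :
    IsLatticePolynomial f ↔
      ((∀ c ∈ latticeConvexHull (Set.range f), f (fun _ => c) = c) ∧
       (∀ (σ : Equiv.Perm (Fin n)) (x x' : Fin n → X),
          Monotone (fun i => x (σ i)) → Monotone (fun i => x' (σ i)) →
          f (x ⊓ x') = f x ⊓ f x') ∧
       (∀ (σ : Equiv.Perm (Fin n)) (x x' : Fin n → X),
          Monotone (fun i => x (σ i)) → Monotone (fun i => x' (σ i)) →
          f (x ⊔ x') = f x ⊔ f x')) := by
  constructor
  · intro hf
    refine ⟨fun c hc => ?_, fun σ x x' => hf.map_inf_of_simplex σ,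
      fun σ x x' => hf.map_sup_of_simplex σ⟩
    have hrange : Set.range f ⊆ Set.Icc (f ⊥) (f ⊤) := by
      rintro _ ⟨x, rfl⟩
      exact ⟨hf.monotone bot_le, hf.monotone le_top⟩
    have hc' := latticeConvexHull_subset_Icc hrange hc
    exact hf.diagonal_eq hc'.1 hc'.2
  · rintro ⟨hdiag, hinf, hsup⟩
    rw [funext (apply_eq_sup_indicatorTuple hdiag hinf hsup)]
    exact .finset_sup _ fun S => .inf (.const _) (.finset_inf S .proj)
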